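/- Let a ∈ (0,1) be real and u ∈ ℍ a unit quaternion (|u| = 1). The quaternionic power series f_a(q) = ∑_{k=0}^∞ qᵏ pₖ with p₀ = a u and pₖ = −(1 − a²) a^{k−1} u for k ≥ 1 converges for every q ∈ 𝔹, satisfies f_a(q) = (1 − a q)⁻¹ (a − q) u for all q ∈ 𝔹, and satisfies |f_a(q)| < 1 for all q ∈ 𝔹 (in particular f_a ∈ SB(𝔹)), since |1 − a q|² − |a − q|² = (1 − a²)(1 − |q|²) > 0. -/

import Mathlib

noncomputable section
open scoped Quaternion

/-- Value of the slice regular function with Taylor coefficients `p` at `q`. -/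
noncomputable def sliceVal (p : ℕ → ℍ[ℝ]) (q : ℍ[ℝ]) : ℍ[ℝ] := ∑' k : ℕ, q ^ k * p k

/-- The power series with coefficients `p` converges on the open unit ball. -/
def SliceRegOn (p : ℕ → ℍ[ℝ]) : Prop :=
  ∀ q : ℍ[ℝ], ‖q‖ < 1 → Summable fun k : ℕ => q ^ k * p k

/-- The class `SB(𝔹)` of slice regular self-maps of the unit ball. -/
def SBClass (p : ℕ → ℍ[ℝ]) : Prop :=
  SliceRegOn p ∧ ∀ q : ℍ[ℝ], ‖q‖ < 1 → ‖sliceVal p q‖ < 1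

/-- The class `SB_n(𝔹)`: members of `SB(𝔹)` whose Taylor coefficients of order
`0, …, n-1` vanish and whose `n`-th Taylor coefficient is nonzero. -/
def SBnClass (n : ℕ) (p : ℕ → ℍ[ℝ]) : Prop :=
  SBClass p ∧ (∀ j, j < n → p j = 0) ∧ p n ≠ 0

/-- Taylor coefficients of the extremal function
`f_a(q) = (1 − a q)⁻¹ (a − q) u = a u − (1 − a²) ∑_{k≥1} q^k a^{k−1} u`. -/
noncomputable def extremalCoeff (a : ℝ) (u : ℍ[ℝ]) : ℕ → ℍ[ℝ]
  | 0 => (a : ℍ[ℝ]) * u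
  | k + 1 => -(((1 - a ^ 2) * a ^ k : ℝ) : ℍ[ℝ]) * u

theorem extremal_hasSum (a : ℝ) (ha0 : 0 < a) (ha1 : a < 1) (u q : ℍ[ℝ]) (hq : ‖q‖ < 1) :
    HasSum (fun k : ℕ => q ^ k * extremalCoeff a u k)
      ((1 - (a : ℍ[ℝ]) * q)⁻¹ * (((a : ℍ[ℝ]) - q) * u)) := by
  have hx : ‖(a : ℍ[ℝ]) * q‖ < 1 := by
    rw [norm_mul, Quaternion.norm_coe, Real.norm_eq_abs, abs_of_pos ha0]
    nlinarith [norm_nonneg q]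
  have hne : (1 - (a : ℍ[ℝ]) * q) ≠ 0 := by
    intro h
    rw [← sub_eq_zero.mp h] at hx
    simp at hx
  have hg := hasSum_geometric_of_norm_lt_one hx
  have hac : ∀ y : ℍ[ℝ], Commute (a : ℍ[ℝ]) y := fun y => Quaternion.coe_commutes a y
  have h1 := (hg.mul_left (-((1 - a ^ 2 : ℝ) : ℍ[ℝ]) * q)).mul_right u
  rw [← hasSum_nat_add_iff' 1]
  convert h1 using 1
  · rfl
  · funext k
    rw [(hac q).mul_pow]
    simp only [extremalCoeff]
    have e1 : ((((1 - a ^ 2) * a ^ k : ℝ)) : ℍ[ℝ])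
        = ((1 - a ^ 2 : ℝ) : ℍ[ℝ]) * (a : ℍ[ℝ]) ^ k := by push_cast; rfl
    have c1 : Commute (q ^ (k + 1)) ((((1 - a ^ 2) * a ^ k : ℝ)) : ℍ[ℝ]) :=
      (Quaternion.coe_commutes _ _).symm
    have c2 : Commute q ((a : ℍ[ℝ]) ^ k) := ((hac q).pow_left k).symm
    rw [neg_mul, mul_neg, ← mul_assoc, c1.eq, e1, neg_mul, neg_mul, neg_mul, pow_succ' q k]
    congr 2
    rw [mul_assoc, mul_assoc, ← mul_assoc q, c2.eq, mul_assoc]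
  · simp only [Finset.sum_range_one, pow_zero, one_mul, extremalCoeff]
    have c : Commute (1 - (a : ℍ[ℝ]) * q) q :=
      (Commute.one_left q).sub_left ((hac q).mul_left (Commute.refl q))
    have c' : Commute (1 - (a : ℍ[ℝ]) * q) (-((1 - a ^ 2 : ℝ) : ℍ[ℝ])) :=
      (Quaternion.coe_commutes (1 - a ^ 2) (1 - (a : ℍ[ℝ]) * q)).symm |> fun h => Commute.neg_right h
    rw [← mul_assoc, ← sub_mul]
    congr 1
    apply mul_left_cancel₀ hne
    rw [mul_sub, mul_inv_cancel_left₀ hne, ← mul_assoc, (c'.mul_right c).eq,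
      mul_inv_cancel_right₀ hne, (hac _).symm.eq]
    push_cast
    noncomm_ring

theorem extremal_norm_id (a : ℝ) (q : ℍ[ℝ]) :
    ‖1 - (a : ℍ[ℝ]) * q‖ ^ 2 - ‖(a : ℍ[ℝ]) - q‖ ^ 2 = (1 - a ^ 2) * (1 - ‖q‖ ^ 2) := by
  simp only [sq ‖_‖, ← Quaternion.normSq_eq_norm_mul_self, Quaternion.normSq_def']
  simp
  ring

theorem extremal_function_in_SB (a : ℝ) (ha0 : 0 < a) (ha1 : a < 1)
    (u : ℍ[ℝ]) (hu : ‖u‖ = 1) :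
    SliceRegOn (extremalCoeff a u) ∧
    (∀ q : ℍ[ℝ], ‖q‖ < 1 →
      sliceVal (extremalCoeff a u) q = (1 - (a : ℍ[ℝ]) * q)⁻¹ * (((a : ℍ[ℝ]) - q) * u)) ∧
    (∀ q : ℍ[ℝ], ‖q‖ < 1 →
      ‖1 - (a : ℍ[ℝ]) * q‖ ^ 2 - ‖(a : ℍ[ℝ]) - q‖ ^ 2 = (1 - a ^ 2) * (1 - ‖q‖ ^ 2) ∧
      0 < (1 - a ^ 2) * (1 - ‖q‖ ^ 2)) ∧
    (∀ q : ℍ[ℝ], ‖q‖ < 1 → ‖sliceVal (extremalCoeff a u) q‖ < 1) ∧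
    SBClass (extremalCoeff a u) := by 
  have hpos : ∀ q : ℍ[ℝ], ‖q‖ < 1 → 0 < (1 - a ^ 2) * (1 - ‖q‖ ^ 2) := fun q hq =>
    mul_pos (by nlinarith) (by nlinarith [norm_nonneg q])
  have hreg : SliceRegOn (extremalCoeff a u) :=
    fun q hq => (extremal_hasSum a ha0 ha1 u q hq).summable
  have hval : ∀ q : ℍ[ℝ], ‖q‖ < 1 →
      sliceVal (extremalCoeff a u) q = (1 - (a : ℍ[ℝ]) * q)⁻¹ * (((a : ℍ[ℝ]) - q) * u) :=
    fun q hq => (extremal_hasSum a ha0 ha1 u q hq).tsum_eq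
  have hlt : ∀ q : ℍ[ℝ], ‖q‖ < 1 → ‖sliceVal (extremalCoeff a u) q‖ < 1 := by
    intro q hq
    have h1 := extremal_norm_id a q
    have h2 := hpos q hq
    have h3 : ‖(a : ℍ[ℝ]) - q‖ < ‖1 - (a : ℍ[ℝ]) * q‖ :=
      lt_of_pow_lt_pow_left₀ 2 (norm_nonneg _) (by linarith)
    have h4 : 0 < ‖1 - (a : ℍ[ℝ]) * q‖ := lt_of_le_of_lt (norm_nonneg _) h3
    rw [hval q hq, norm_mul, norm_mul, norm_inv, hu, mul_one, inv_mul_lt_iff₀ h4, mul_one]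
    exact h3
  exact ⟨hreg, hval, fun q hq => ⟨extremal_norm_id a q, hpos q hq⟩, hlt, hreg, hlt⟩
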